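/- arXiv:2203.02496 — 7 statements merged into one kernel-verified Lean document; each statement's English description precedes it below -/
import Mathlib

section
/- Let C ≥ 1, let T ∈ ℝ^{C×C} be an invertible column-stochastic matrix, and let p, q ∈ Δ^C be such that every entry of the vector Tq is positive. Then KL(Tp ‖ Tq) ≥ (1/2) · (p_{j(p)} − p_{j(q)})² / ‖T⁻¹‖₁². (This is the explicit convex lower bound on the calibration function of the forward-corrected log loss: the excess inner 0-1 risk p_{j(p)} − p_{j(q)} is controlled by the excess inner forward-corrected log-loss risk KL(Tp‖Tq).) -/
/-- The smallest index attaining the maximum of `q`. -/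
noncomputable def jmax {C : ℕ} (hC : 0 < C) (q : Fin C → ℝ) : Fin C :=
  (Finset.univ.filter (fun i => ∀ k, q k ≤ q i)).min' (by
    haveI : Nonempty (Fin C) := ⟨⟨0, hC⟩⟩
    obtain ⟨b, -, hb⟩ := Finset.exists_max_image (Finset.univ : Finset (Fin C)) q
      Finset.univ_nonempty
    exact ⟨b, Finset.mem_filter.mpr ⟨Finset.mem_univ b, fun k => hb k (Finset.mem_univ k)⟩⟩)

/-- The matrix 1-norm `‖M‖₁ = max_j ∑_i |M i j|`. -/
noncomputable def matOneNorm {C : ℕ} (hC : 0 < C) (M : Matrix (Fin C) (Fin C) ℝ) : ℝ :=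
  Finset.univ.sup' (by haveI : Nonempty (Fin C) := ⟨⟨0, hC⟩⟩; exact Finset.univ_nonempty)
    (fun j => ∑ i, |M i j|)

/-- Kullback–Leibler divergence, with the convention that a term vanishes when `u i = 0`. -/
noncomputable def KLdiv {C : ℕ} (u v : Fin C → ℝ) : ℝ :=
  ∑ i, if u i = 0 then 0 else u i * Real.log (u i / v i)

lemma hasDerivAt_log_sub_ratio {x : ℝ} (hx : 0 < x) :
    HasDerivAt (fun y : ℝ => Real.log y - (5 * y ^ 2 - 4 * y - 1) / (2 * y ^ 2 + 4 * y))
      ((x - 1) ^ 3 / (x ^ 2 * (x + 2) ^ 2)) x := by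
  have hden : 2 * x ^ 2 + 4 * x ≠ 0 := by positivity
  have hnum : HasDerivAt (fun y : ℝ => 5 * y ^ 2 - 4 * y - 1) (10 * x - 4) x := by
    have h := ((((hasDerivAt_id x).pow 2).const_mul 5).sub
      ((hasDerivAt_id x).const_mul 4)).sub_const 1
    exact h.congr_deriv (by norm_num; ring)
  have hden' : HasDerivAt (fun y : ℝ => 2 * y ^ 2 + 4 * y) (4 * x + 4) x := by
    have h := (((hasDerivAt_id x).pow 2).const_mul 2).add ((hasDerivAt_id x).const_mul 4)
    exact h.congr_deriv (by norm_num; ring)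
  have h := (Real.hasDerivAt_log hx.ne').sub (hnum.div hden' hden)
  refine h.congr_deriv ?_
  have hx2 : x + 2 ≠ 0 := by positivity
  have e : 2 * x ^ 2 + 4 * x = 2 * x * (x + 2) := by ring
  rw [e]
  field_simp
  ring

/-- A rational lower bound on the logarithm, tight to third order at `1`. -/
lemma ratio_le_log {x : ℝ} (hx : 0 < x) :
    (5 * x ^ 2 - 4 * x - 1) / (2 * x ^ 2 + 4 * x) ≤ Real.log x := by
  rcases le_total x 1 with h1 | h1
  · have hanti : AntitoneOn
        (fun y : ℝ => Real.log y - (5 * y ^ 2 - 4 * y - 1) / (2 * y ^ 2 + 4 * y))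
        (Set.Icc x 1) := by
      refine antitoneOn_of_deriv_nonpos (convex_Icc _ _) ?_ ?_ ?_
      · exact fun y hy => (hasDerivAt_log_sub_ratio
          (hx.trans_le hy.1)).continuousAt.continuousWithinAt
      · intro y hy
        rw [interior_Icc] at hy
        exact (hasDerivAt_log_sub_ratio
          (hx.trans hy.1)).differentiableAt.differentiableWithinAt
      · intro y hy
        rw [interior_Icc] at hy
        rw [(hasDerivAt_log_sub_ratio (hx.trans hy.1)).deriv]
        exact div_nonpos_of_nonpos_of_nonneg
          ((Odd.pow_nonpos_iff (by decide)).2 (by linarith [hy.2])) (by positivity)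
    have h := hanti (Set.left_mem_Icc.2 h1) (Set.right_mem_Icc.2 h1) h1
    norm_num at h
    exact h
  · have hmono : MonotoneOn
        (fun y : ℝ => Real.log y - (5 * y ^ 2 - 4 * y - 1) / (2 * y ^ 2 + 4 * y))
        (Set.Icc 1 x) := by
      refine monotoneOn_of_deriv_nonneg (convex_Icc _ _) ?_ ?_ ?_
      · exact fun y hy => (hasDerivAt_log_sub_ratio
          (one_pos.trans_le hy.1)).continuousAt.continuousWithinAt
      · intro y hy
        rw [interior_Icc] at hy
        exact (hasDerivAt_log_sub_ratio
          (one_pos.trans hy.1)).differentiableAt.differentiableWithinAt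
      · intro y hy
        rw [interior_Icc] at hy
        rw [(hasDerivAt_log_sub_ratio (one_pos.trans hy.1)).deriv]
        exact div_nonneg (pow_nonneg (by linarith [hy.1]) 3) (by positivity)
    have h := hmono (Set.left_mem_Icc.2 h1) (Set.right_mem_Icc.2 h1) h1
    norm_num at h
    exact h

lemma sq_sub_div_le_KL_term {u v : ℝ} (hu : 0 ≤ u) (hv : 0 < v) :
    3 / 2 * ((u - v) ^ 2 / (u + 2 * v)) ≤
      (if u = 0 then 0 else u * Real.log (u / v)) - u + v := by
  split_ifs with h0
  · subst h0
    have : (0 - v) ^ 2 / (0 + 2 * v) = v / 2 := by field_simp; ring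
    rw [this]
    linarith
  · have hu' : 0 < u := lt_of_le_of_ne hu (Ne.symm h0)
    have h := mul_le_mul_of_nonneg_left (ratio_le_log (div_pos hu' hv)) hu
    have e : u * ((5 * (u / v) ^ 2 - 4 * (u / v) - 1) / (2 * (u / v) ^ 2 + 4 * (u / v)))
        = 3 / 2 * ((u - v) ^ 2 / (u + 2 * v)) + u - v := by
      have h1 : u + 2 * v ≠ 0 := by positivity
      have h2 : 2 * (u / v) ^ 2 + 4 * (u / v) = 2 * u * (u + 2 * v) / v ^ 2 := by
        field_simp
        ring
      rw [h2]
      field_simp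
      ring
    linarith

/-- Pinsker's inequality on a finite alphabet. -/
lemma pinsker_KLdiv {C : ℕ} {u v : Fin C → ℝ} (hu : ∀ i, 0 ≤ u i) (hv : ∀ i, 0 < v i)
    (hu1 : ∑ i, u i = 1) (hv1 : ∑ i, v i = 1) :
    1 / 2 * (∑ i, |u i - v i|) ^ 2 ≤ KLdiv u v := by
  have hcs := Finset.sq_sum_div_le_sum_sq_div Finset.univ (fun i => |u i - v i|)
    (g := fun i => u i + 2 * v i) (fun i _ => by have := hu i; have := hv i; positivity)
  have hden : ∑ i, (u i + 2 * v i) = 3 := by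
    rw [Finset.sum_add_distrib, ← Finset.mul_sum, hu1, hv1]
    norm_num
  simp only [sq_abs, hden] at hcs
  have hsum := Finset.sum_le_sum fun i (_ : i ∈ Finset.univ) =>
    sq_sub_div_le_KL_term (hu i) (hv i)
  rw [← Finset.mul_sum, Finset.sum_add_distrib, Finset.sum_sub_distrib, hu1, hv1] at hsum
  unfold KLdiv
  linarith

lemma le_jmax {C : ℕ} (hC : 0 < C) (q : Fin C → ℝ) (k : Fin C) : q k ≤ q (jmax hC q) :=
  (Finset.mem_filter.1 (Finset.min'_mem (Finset.univ.filter fun i => ∀ k, q k ≤ q i) _)).2 k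

lemma sub_jmax_le_sum_abs {C : ℕ} (hC : 0 < C) (p q : Fin C → ℝ) :
    p (jmax hC p) - p (jmax hC q) ≤ ∑ i, |p i - q i| := by
  by_cases h : jmax hC p = jmax hC q
  · rw [h, sub_self]
    exact Finset.sum_nonneg fun i _ => abs_nonneg _
  · have hpair := Finset.sum_le_sum_of_subset_of_nonneg
      (Finset.subset_univ {jmax hC p, jmax hC q}) (f := fun i => |p i - q i|)
      (fun i _ _ => abs_nonneg _)
    rw [Finset.sum_pair h] at hpair
    have h1 := le_abs_self (p (jmax hC p) - q (jmax hC p))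
    have h2 := neg_abs_le (p (jmax hC q) - q (jmax hC q))
    have h3 := le_jmax hC q (jmax hC p)
    linarith

lemma sum_abs_mulVec_le {C : ℕ} (hC : 0 < C) (M : Matrix (Fin C) (Fin C) ℝ) (x : Fin C → ℝ) :
    ∑ i, |M.mulVec x i| ≤ matOneNorm hC M * ∑ j, |x j| := by
  calc ∑ i, |M.mulVec x i| ≤ ∑ i, ∑ j, |M i j| * |x j| := by
        refine Finset.sum_le_sum fun i _ => ?_
        simp only [← abs_mul]
        exact Finset.abs_sum_le_sum_abs (fun j => M i j * x j) Finset.univ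
    _ = ∑ j, (∑ i, |M i j|) * |x j| := by
        rw [Finset.sum_comm]
        simp only [Finset.sum_mul]
    _ ≤ ∑ j, matOneNorm hC M * |x j| :=
        Finset.sum_le_sum fun j _ => mul_le_mul_of_nonneg_right
          (Finset.le_sup' (fun j => ∑ i, |M i j|) (Finset.mem_univ j)) (abs_nonneg _)
    _ = matOneNorm hC M * ∑ j, |x j| := (Finset.mul_sum _ _ _).symm

lemma sum_mulVec_of_col_sum_one {C : ℕ} {T : Matrix (Fin C) (Fin C) ℝ}
    (hT : ∀ j, ∑ i, T i j = 1) (x : Fin C → ℝ) : ∑ i, T.mulVec x i = ∑ j, x j := by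
  simp only [Matrix.mulVec, dotProduct]
  rw [Finset.sum_comm]
  simp only [← Finset.sum_mul, hT, one_mul]

theorem stmt0 {C : ℕ} (hC : 0 < C) (T : Matrix (Fin C) (Fin C) ℝ)
    (hTnn : ∀ i j, 0 ≤ T i j) (hTcol : ∀ j, ∑ i, T i j = 1) (hTdet : IsUnit T.det)
    (p q : Fin C → ℝ)
    (hp0 : ∀ i, 0 ≤ p i) (hp1 : ∑ i, p i = 1)
    (hq0 : ∀ i, 0 ≤ q i) (hq1 : ∑ i, q i = 1)
    (hTq : ∀ i, 0 < T.mulVec q i) :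
    (1/2) * (p (jmax hC p) - p (jmax hC q))^2 / (matOneNorm hC T⁻¹)^2
      ≤ KLdiv (T.mulVec p) (T.mulVec q) := by
  have hnn : ∀ i, 0 ≤ T.mulVec p i := fun i => by
    simp only [Matrix.mulVec, dotProduct]
    exact Finset.sum_nonneg fun j _ => mul_nonneg (hTnn i j) (hp0 j)
  have hpin := pinsker_KLdiv hnn hTq
    ((sum_mulVec_of_col_sum_one hTcol p).trans hp1) ((sum_mulVec_of_col_sum_one hTcol q).trans hq1)
  refine le_trans ?_ hpin
  have hinv : T⁻¹.mulVec (T.mulVec p - T.mulVec q) = p - q := by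
    rw [← Matrix.mulVec_sub, Matrix.mulVec_mulVec, Matrix.nonsing_inv_mul T hTdet,
      Matrix.one_mulVec]
  have hnorm := sum_abs_mulVec_le hC T⁻¹ (T.mulVec p - T.mulVec q)
  rw [hinv] at hnorm
  simp only [Pi.sub_apply] at hnorm
  have hle := (sub_jmax_le_sum_abs hC p q).trans hnorm
  have hsub : 0 ≤ p (jmax hC p) - p (jmax hC q) := sub_nonneg.2 (le_jmax hC p _)
  have hsq := pow_le_pow_left₀ hsub hle 2
  rw [mul_pow] at hsq
  refine div_le_of_le_mul₀ (sq_nonneg _) (by positivity) ?_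
  linarith
end

section
/- Let C ≥ 1, let ℓ : Δ^C × {1,…,C} → ℝ be a strictly proper loss, let T ∈ ℝ^{C×C} be an invertible column-stochastic matrix, and let η ∈ Δ^C. Then the function q ↦ ∑_{c=1}^C (Tη)_c ℓ(Tq, c) on Δ^C attains its minimum uniquely at q = η. (The inner forward-corrected risk under the noisy class-probability vector Tη has the clean class-probability vector η as its unique minimizer.) -/
/-- The probability simplex in `ℝ^C`. -/
def simplex (C : ℕ) : Set (Fin C → ℝ) :=
  {p | (∀ i, 0 ≤ p i) ∧ ∑ i, p i = 1}

/-- A column-stochastic matrix maps the probability simplex to itself. -/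
theorem mulVec_mem_simplex {C : ℕ} {T : Matrix (Fin C) (Fin C) ℝ}
    (hTnn : ∀ i j, 0 ≤ T i j) (hTcol : ∀ j, ∑ i, T i j = 1)
    {p : Fin C → ℝ} (hp : p ∈ simplex C) : T.mulVec p ∈ simplex C := by
  simp only [simplex, Matrix.mulVec, dotProduct, Set.mem_ofPred_eq]
  refine ⟨fun i => Finset.sum_nonneg fun j _ => mul_nonneg (hTnn i j) (hp.1 j), ?_⟩
  rw [Finset.sum_comm]
  simp only [← Finset.sum_mul, hTcol, one_mul, hp.2]

theorem stmt4 {C : ℕ} (hC : 0 < C) (ℓ : (Fin C → ℝ) → Fin C → ℝ)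
    (hproper : ∀ p ∈ simplex C, ∀ q ∈ simplex C, q ≠ p →
      ∑ c, p c * ℓ p c < ∑ c, p c * ℓ q c)
    (T : Matrix (Fin C) (Fin C) ℝ)
    (hTnn : ∀ i j, 0 ≤ T i j) (hTcol : ∀ j, ∑ i, T i j = 1) (hTdet : IsUnit T.det)
    (η : Fin C → ℝ) (hη : η ∈ simplex C) :
    ∀ q ∈ simplex C, q ≠ η →
      ∑ c, T.mulVec η c * ℓ (T.mulVec η) c < ∑ c, T.mulVec η c * ℓ (T.mulVec q) c := by
  intro q hq hne
  refine hproper _ (mulVec_mem_simplex hTnn hTcol hη) _ (mulVec_mem_simplex hTnn hTcol hq) ?_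
  exact fun h => hne
    (Matrix.mulVec_injective_of_isUnit ((Matrix.isUnit_iff_isUnit_det T).2 hTdet) h)
end

section
/- Let C ≥ 1, let T = (t_{i,j}) ∈ ℝ^{C×C} be a column-stochastic matrix, and let y ∈ {1,…,C} be such that ∑_{j=1}^C t_{y,j} > 0. Then the function λ : ℝ^C → ℝ defined by λ(s) = −log( ∑_{k=1}^C t_{y,k} e^{s_k} / ∑_{j=1}^C e^{s_j} ) is Lipschitz continuous with Lipschitz constant √2 with respect to the Euclidean norm on ℝ^C. (λ is the forward-corrected log loss composed with the softmax link; i.e., the forward-corrected cross-entropy loss in logit space has Lipschitz constant at most √2.) -/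
theorem sum_mul_exp_pos {ι : Type*} [Fintype ι] {w : ι → ℝ} (hw : ∀ i, 0 ≤ w i)
    (hsum : 0 < ∑ i, w i) (s : ι → ℝ) : 0 < ∑ i, w i * Real.exp (s i) := by
  obtain ⟨i, hi, hpos⟩ := Finset.exists_lt_of_sum_lt (s := Finset.univ) (f := fun _ : ι => (0 : ℝ))
    (g := w) (by simpa using hsum)
  exact Finset.sum_pos' (fun j _ => mul_nonneg (hw j) (Real.exp_pos _).le)
    ⟨i, hi, mul_pos hpos (Real.exp_pos _)⟩

/-- The weighted log-sum-exp function increases by at most the largest coordinate increment. -/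
theorem log_sum_mul_exp_le {ι : Type*} [Fintype ι] {w : ι → ℝ} (hw : ∀ i, 0 ≤ w i)
    (hsum : 0 < ∑ i, w i) {s s' : ι → ℝ} {c : ℝ} (h : ∀ i, s i ≤ s' i + c) :
    Real.log (∑ i, w i * Real.exp (s i)) ≤ Real.log (∑ i, w i * Real.exp (s' i)) + c := by
  rw [Real.log_le_iff_le_exp (sum_mul_exp_pos hw hsum s), Real.exp_add,
    Real.exp_log (sum_mul_exp_pos hw hsum s'), Finset.sum_mul]
  refine Finset.sum_le_sum fun i _ => ?_
  rw [mul_assoc, ← Real.exp_add]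
  exact mul_le_mul_of_nonneg_left (Real.exp_le_exp.2 (h i)) (hw i)

theorem sub_le_sqrt_two_mul_sqrt_sum_sq {ι : Type*} [Fintype ι] (d : ι → ℝ) (i j : ι) :
    d i - d j ≤ Real.sqrt 2 * Real.sqrt (∑ k, d k ^ 2) := by
  classical
  rw [← Real.sqrt_mul zero_le_two]
  refine Real.le_sqrt_of_sq_le ?_
  rcases eq_or_ne i j with rfl | hij
  · rw [sub_self, zero_pow two_ne_zero]
    positivity
  · have hle : d i ^ 2 + d j ^ 2 ≤ ∑ k, d k ^ 2 := by
      rw [← Finset.sum_pair hij (f := fun k => d k ^ 2)]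
      exact Finset.sum_le_univ_sum_of_nonneg fun k => sq_nonneg (d k)
    nlinarith [sq_nonneg (d i + d j)]

/-- A difference of two weighted log-sum-exp functions is one-sidedly `√2`-Lipschitz. -/
theorem log_sum_mul_exp_sub_le {ι : Type*} [Fintype ι] [Nonempty ι] {v w : ι → ℝ}
    (hv : ∀ i, 0 ≤ v i) (hvsum : 0 < ∑ i, v i) (hw : ∀ i, 0 ≤ w i) (hwsum : 0 < ∑ i, w i)
    (s s' : ι → ℝ) :
    (Real.log (∑ i, v i * Real.exp (s i)) - Real.log (∑ i, w i * Real.exp (s i)))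
      - (Real.log (∑ i, v i * Real.exp (s' i)) - Real.log (∑ i, w i * Real.exp (s' i)))
      ≤ Real.sqrt 2 * Real.sqrt (∑ i, (s i - s' i) ^ 2) := by
  obtain ⟨a, ha⟩ := Finite.exists_max fun i => s i - s' i
  obtain ⟨b, hb⟩ := Finite.exists_min fun i => s i - s' i
  have hmax := log_sum_mul_exp_le hv hvsum (s := s) (s' := s') (c := s a - s' a)
    fun i => by linarith [ha i]
  have hmin := log_sum_mul_exp_le hw hwsum (s := s') (s' := s) (c := -(s b - s' b))
    fun i => by linarith [hb i]
  have hosc := sub_le_sqrt_two_mul_sqrt_sum_sq (fun i => s i - s' i) a b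
  linarith

theorem stmt7 {C : ℕ} (hC : 0 < C) (T : Matrix (Fin C) (Fin C) ℝ)
    (hTnn : ∀ i j, 0 ≤ T i j) (hTcol : ∀ j, ∑ i, T i j = 1)
    (y : Fin C) (hy : 0 < ∑ j, T y j) :
    ∀ s s' : Fin C → ℝ,
      |(-Real.log ((∑ k, T y k * Real.exp (s k)) / (∑ j, Real.exp (s j))))
        - (-Real.log ((∑ k, T y k * Real.exp (s' k)) / (∑ j, Real.exp (s' j))))|
      ≤ Real.sqrt 2 * Real.sqrt (∑ i, (s i - s' i)^2) := by
  intro s s'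
  have : Nonempty (Fin C) := ⟨y⟩
  have hone : ∀ _ : Fin C, (0 : ℝ) ≤ 1 := fun _ => zero_le_one
  have honesum : (0 : ℝ) < ∑ _ : Fin C, 1 := by simpa using hC
  have hlog (r : Fin C → ℝ) :
      Real.log ((∑ k, T y k * Real.exp (r k)) / ∑ j, Real.exp (r j))
        = Real.log (∑ k, T y k * Real.exp (r k)) - Real.log (∑ j, 1 * Real.exp (r j)) := by
    have hpos := sum_mul_exp_pos hone honesum r
    rw [← Real.log_div (sum_mul_exp_pos (hTnn y) hy r).ne' hpos.ne']
    simp only [one_mul]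
  have hle := log_sum_mul_exp_sub_le hone honesum (hTnn y) hy s s'
  have hge := log_sum_mul_exp_sub_le (hTnn y) hy hone honesum s s'
  rw [hlog s, hlog s', abs_le]
  constructor <;> linarith
end

section
/- Let C ≥ 1, let 0 ≤ α < 1, let I be the C×C identity matrix, let N be the C×C matrix all of whose entries equal 1/C, and let T = (1−α)I + αN. Then ‖T⁻¹‖₁ = (1−α)⁻¹ (1 + (1 − 2/C)α), where ‖M‖₁ = max_{1≤j≤C} ∑_{i=1}^C |M(i,j)| is the matrix 1-norm. -/
/-- The inverse of `(1 - α) • 1 + α • N` for an idempotent matrix `N`. -/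
theorem inv_smul_one_add_smul_of_mul_self {n : Type*} [Fintype n] [DecidableEq n]
    {N : Matrix n n ℝ} (hN : N * N = N) {α : ℝ} (hα : α ≠ 1) :
    ((1 - α) • (1 : Matrix n n ℝ) + α • N)⁻¹ = (1 - α)⁻¹ • (1 - α • N) := by
  have h : 1 - α ≠ 0 := sub_ne_zero.mpr hα.symm
  apply Matrix.inv_eq_right_inv
  have key : ((1 - α) • (1 : Matrix n n ℝ) + α • N) * (1 - α • N) = (1 - α) • 1 := by
    simp only [add_mul, mul_sub, smul_mul_assoc, mul_smul_comm, one_mul, mul_one, hN]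
    module
  rw [mul_smul_comm, key, smul_smul, inv_mul_cancel₀ h, one_smul]

theorem stmt10 {C : ℕ} (hC : 0 < C) (α : ℝ) (hα0 : 0 ≤ α) (hα1 : α < 1)
    (N : Matrix (Fin C) (Fin C) ℝ) (hN : ∀ i j, N i j = 1 / C)
    (T : Matrix (Fin C) (Fin C) ℝ)
    (hT : T = (1 - α) • (1 : Matrix (Fin C) (Fin C) ℝ) + α • N) :
    matOneNorm hC T⁻¹ = (1 - α)⁻¹ * (1 + (1 - 2 / (C : ℝ)) * α) := by
  have hC1 : (1 : ℝ) ≤ C := by exact_mod_cast hC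
  have hC0 : (C : ℝ) ≠ 0 := by positivity
  have hNN : N * N = N := by
    ext i j
    simp [Matrix.mul_apply, hN, hC0]
  have hnonneg : 0 ≤ α / C := by positivity
  have hle : α / C ≤ 1 := (div_le_self hα0 hC1).trans hα1.le
  have hpos : 0 < (1 - α)⁻¹ := inv_pos.mpr (sub_pos.mpr hα1)
  have hentry : ∀ i j, |T⁻¹ i j| =
      (1 - α)⁻¹ * ((if i = j then 1 - 2 * (α / C) else 0) + α / C) := by
    intro i j
    rw [hT, inv_smul_one_add_smul_of_mul_self hNN hα1.ne, Matrix.smul_apply, smul_eq_mul,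
      abs_mul, abs_of_pos hpos, Matrix.sub_apply, Matrix.smul_apply, hN, smul_eq_mul,
      mul_one_div, Matrix.one_apply]
    split_ifs
    · rw [abs_of_nonneg (by linarith)]
      ring
    · rw [zero_sub, abs_neg, abs_of_nonneg hnonneg, zero_add]
  have hcol : ∀ j, ∑ i, |T⁻¹ i j| = (1 - α)⁻¹ * (1 + (1 - 2 / (C : ℝ)) * α) := by
    intro j
    simp only [hentry, ← Finset.mul_sum, Finset.sum_add_distrib, Finset.sum_ite_eq',
      Finset.mem_univ, if_true, Finset.sum_const, Finset.card_univ,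
      Fintype.card_fin, nsmul_eq_mul]
    field_simp
    ring
  simp only [matOneNorm, hcol, Finset.sup'_const]
end

section
/- Let X be a set, x_1, …, x_M ∈ X, a_1, …, a_M ≥ 0, let G be a set of functions X → ℝ, and let μ : ℝ → ℝ be Lipschitz with constant L ≥ 0. Assume that for every sign vector ε ∈ {−1,1}^M both sup_{g∈G} ∑_{i=1}^M a_i ε_i g(x_i) and sup_{g∈G} ∑_{i=1}^M a_i ε_i μ(g(x_i)) are finite. Then Rad_{S,a}(μ ∘ G) ≤ L · Rad_{S,a}(G), where μ ∘ G = {μ ∘ g : g ∈ G}. (Lipschitz contraction property of the weighted Rademacher average.) -/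
/-- The weighted Rademacher average of a class `G` of real-valued functions, at sample
points `x 1, …, x M` with nonnegative weights `a`: the expectation over i.i.d. uniform
signs of the supremum of the signed weighted sums. -/
noncomputable def Rad {X : Type*} {M : ℕ} (x : Fin M → X) (a : Fin M → ℝ)
    (G : Set (X → ℝ)) : ℝ :=
  (∑ ε : Fin M → Bool,
    sSup ((fun g => ∑ i, a i * (if ε i then (1 : ℝ) else -1) * g (x i)) '' G)) / 2 ^ M

theorem ciSup_add_add_ciSup_sub_le {ι : Type*} [Nonempty ι] {f u v : ι → ℝ}
    (h : ∀ g k, |u g - u k| ≤ |v g - v k|)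
    (hadd : BddAbove (Set.range fun g => f g + v g))
    (hsub : BddAbove (Set.range fun g => f g - v g)) :
    (⨆ g, (f g + u g)) + (⨆ g, (f g - u g)) ≤ (⨆ g, (f g + v g)) + (⨆ g, (f g - v g)) := by
  have key : ∀ g k, (f g + u g) + (f k - u k) ≤
      (⨆ g, (f g + v g)) + (⨆ g, (f g - v g)) := by
    intro g k
    have h1 := le_ciSup hadd g
    have h2 := le_ciSup hadd k
    have h3 := le_ciSup hsub g
    have h4 := le_ciSup hsub k
    have h5 := (le_abs_self _).trans (h g k)
    rcases abs_cases (v g - v k) with ⟨h6, -⟩ | ⟨h6, -⟩ <;> linarith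
  rw [← le_sub_iff_add_le]
  refine ciSup_le fun g => ?_
  rw [le_sub_comm]
  exact ciSup_le fun k => by linarith [key g k]

theorem sum_signs_ciSup_le {ι : Type*} [Nonempty ι] {n : ℕ} (u v : Fin n → ι → ℝ)
    (h : ∀ i g k, |u i g - u i k| ≤ |v i g - v i k|)
    (hu : ∀ i, ∃ B, ∀ g, |u i g| ≤ B) (hv : ∀ i, ∃ B, ∀ g, |v i g| ≤ B)
    (f : ι → ℝ) (hf : ∃ B, ∀ g, |f g| ≤ B) :
    ∑ ε : Fin n → Bool, ⨆ g, (f g + ∑ i, (if ε i then (1 : ℝ) else -1) * u i g) ≤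
      ∑ ε : Fin n → Bool, ⨆ g, (f g + ∑ i, (if ε i then (1 : ℝ) else -1) * v i g) := by
  induction n generalizing f with
  | zero => simp
  | succ n ih =>
    have split : ∀ w : Fin (n + 1) → ι → ℝ,
        ∑ ε : Fin (n + 1) → Bool, ⨆ g, (f g + ∑ i, (if ε i then (1 : ℝ) else -1) * w i g) =
        (∑ ε : Fin n → Bool,
          ⨆ g, ((f g + w 0 g) + ∑ i, (if ε i then (1 : ℝ) else -1) * w i.succ g)) +
        ∑ ε : Fin n → Bool,
          ⨆ g, ((f g - w 0 g) + ∑ i, (if ε i then (1 : ℝ) else -1) * w i.succ g) := by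
      intro w
      rw [← (Fin.consEquiv fun _ => Bool).sum_comp, Fintype.sum_prod_type, Fintype.sum_bool]
      simp [Fin.consEquiv, Fin.sum_univ_succ, add_assoc, sub_eq_add_neg]
    obtain ⟨Bf, hBf⟩ := hf
    obtain ⟨B₀, hB₀⟩ := hv 0
    have step (ε : Fin n → Bool) :
        (⨆ g, ((f g + u 0 g) + ∑ i, (if ε i then (1 : ℝ) else -1) * u i.succ g)) +
        (⨆ g, ((f g - u 0 g) + ∑ i, (if ε i then (1 : ℝ) else -1) * u i.succ g)) ≤
        (⨆ g, ((f g + v 0 g) + ∑ i, (if ε i then (1 : ℝ) else -1) * u i.succ g)) +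
        (⨆ g, ((f g - v 0 g) + ∑ i, (if ε i then (1 : ℝ) else -1) * u i.succ g)) := by
      choose B hB using hu
      have hsum (g : ι) :
          ∑ i : Fin n, (if ε i then (1 : ℝ) else -1) * u i.succ g ≤ ∑ i : Fin n, B i.succ := by
        refine Finset.sum_le_sum fun i _ => ?_
        have := abs_le.1 (hB i.succ g)
        split_ifs <;> linarith
      have swap_add (c s : ι → ℝ) :
          (⨆ g, ((f g + c g) + s g)) = ⨆ g, ((f g + s g) + c g) := by
        simp only [add_right_comm]
      have swap_sub (c s : ι → ℝ) :
          (⨆ g, ((f g - c g) + s g)) = ⨆ g, ((f g + s g) - c g) := by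
        simp only [sub_add_eq_add_sub]
      rw [swap_add (u 0), swap_add (v 0), swap_sub (u 0), swap_sub (v 0)]
      refine ciSup_add_add_ciSup_sub_le (h 0) ?_ ?_ <;>
      · refine ⟨Bf + ∑ i : Fin n, B i.succ + B₀, ?_⟩
        rintro _ ⟨g, rfl⟩
        have := abs_le.1 (hBf g)
        have := abs_le.1 (hB₀ g)
        have := hsum g
        dsimp only
        linarith
    rw [split, split, ← Finset.sum_add_distrib]
    refine (Finset.sum_le_sum fun ε _ => step ε).trans ?_
    rw [Finset.sum_add_distrib]
    have ih' := ih (fun i => u i.succ) (fun i => v i.succ) (fun i => h i.succ)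
      (fun i => hu i.succ) (fun i => hv i.succ)
    exact add_le_add
      (ih' (fun g => f g + v 0 g)
        ⟨Bf + B₀, fun g => (abs_add_le _ _).trans (add_le_add (hBf g) (hB₀ g))⟩)
      (ih' (fun g => f g - v 0 g)
        ⟨Bf + B₀, fun g => (abs_sub _ _).trans (add_le_add (hBf g) (hB₀ g))⟩)

theorem exists_abs_le_of_bddAbove_signed_sums {ι : Type*} {n : ℕ} (w : Fin n → ι → ℝ)
    (h : ∀ ε : Fin n → Bool,
      BddAbove (Set.range fun g => ∑ i, (if ε i then (1 : ℝ) else -1) * w i g)) (i : Fin n) :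
    ∃ B, ∀ g, |w i g| ≤ B := by
  choose B hB using h
  refine ⟨∑ ε, |B ε|, fun g => ?_⟩
  calc
    |w i g| ≤ ∑ j, |w j g| :=
      Finset.single_le_sum (f := fun j => |w j g|) (fun _ _ => abs_nonneg _) (Finset.mem_univ i)
    _ = ∑ j, (if decide (0 ≤ w j g) then (1 : ℝ) else -1) * w j g := by
      refine Finset.sum_congr rfl fun j _ => ?_
      by_cases hj : 0 ≤ w j g
      · simp [hj]
      · simp [hj, abs_of_neg (not_le.1 hj)]
    _ ≤ B fun j => decide (0 ≤ w j g) := hB (fun j => decide (0 ≤ w j g)) ⟨g, rfl⟩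
    _ ≤ |B fun j => decide (0 ≤ w j g)| := le_abs_self _
    _ ≤ ∑ ε, |B ε| :=
      Finset.single_le_sum (f := fun ε => |B ε|) (fun _ _ => abs_nonneg _) (Finset.mem_univ _)

theorem stmt14 {X : Type*} {M : ℕ} (x : Fin M → X) (a : Fin M → ℝ) (ha : ∀ i, 0 ≤ a i)
    (G : Set (X → ℝ)) (hG : G.Nonempty)
    (μ : ℝ → ℝ) (L : ℝ) (hL : 0 ≤ L) (hμ : ∀ s t : ℝ, |μ s - μ t| ≤ L * |s - t|)
    (hbdd : ∀ ε : Fin M → Bool,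
      BddAbove ((fun g => ∑ i, a i * (if ε i then (1 : ℝ) else -1) * g (x i)) '' G))
    (hbddμ : ∀ ε : Fin M → Bool,
      BddAbove ((fun g => ∑ i, a i * (if ε i then (1 : ℝ) else -1) * μ (g (x i))) '' G)) :
    Rad x a ((fun g => μ ∘ g) '' G) ≤ L * Rad x a G := by
  have : Nonempty G := hG.to_subtype
  have comm (ε : Fin M → Bool) (i : Fin M) (t : ℝ) :
      a i * (if ε i then (1 : ℝ) else -1) * t = (if ε i then (1 : ℝ) else -1) * (a i * t) := by
    ring
  simp only [comm, Set.image_eq_range] at hbdd hbddμ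
  have hu := exists_abs_le_of_bddAbove_signed_sums
    (fun i (g : G) => a i * μ (g.1 (x i))) hbddμ
  have hv := exists_abs_le_of_bddAbove_signed_sums
    (fun i (g : G) => a i * g.1 (x i)) hbdd
  have main := sum_signs_ciSup_le (fun i (g : G) => a i * μ (g.1 (x i)))
    (fun i (g : G) => L * (a i * g.1 (x i)))
    (fun i g k => by
      rw [← mul_sub, ← mul_sub, ← mul_sub, abs_mul, abs_mul, abs_mul, abs_of_nonneg (ha i),
        abs_of_nonneg hL, mul_left_comm]
      exact mul_le_mul_of_nonneg_left (hμ _ _) (ha i))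
    hu
    (fun i => by
      obtain ⟨B, hB⟩ := hv i
      refine ⟨L * B, fun g => ?_⟩
      rw [abs_mul, abs_of_nonneg hL]
      exact mul_le_mul_of_nonneg_left (hB g) hL)
    (fun _ => 0) ⟨0, fun _ => by simp⟩
  simp only [zero_add, mul_left_comm _ L, ← Finset.mul_sum, ← Real.mul_iSup_of_nonneg hL] at main
  simp only [Rad, Set.image_image, Function.comp_apply, comm, sSup_image']
  rw [← mul_div_assoc]
  exact div_le_div_of_nonneg_right main (by positivity)
end

section
/- Let X be a set, x ∈ X, C ≥ 1, let H be a set of functions X → ℝ^C, let φ : (X → ℝ^C) → ℝ, let a > 0, and let λ : ℝ^C → ℝ be Lipschitz with constant L ≥ 0 with respect to the Euclidean norm on ℝ^C. Assume all suprema appearing below are finite. Then (1/2) ∑_{ε ∈ {−1,1}} sup_{f∈H} ( ε · a · λ(f(x)) + φ(f) ) ≤ 2^{−C} ∑_{(ε_1,…,ε_C) ∈ {−1,1}^C} sup_{f∈H} ( √2 · a · L · ∑_{c=1}^C ε_c f_c(x) + φ(f) ), where f_c(x) denotes the c-th coordinate of f(x). (Single-point vector-valued Rademacher contraction: a Rademacher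 sign applied to a Lipschitz function of a vector-valued evaluation can be replaced, at the cost of a factor √2·L, by independent signs on the coordinates.) -/
/-- The real sign `±1` encoded by a Boolean. -/
def boolSign (b : Bool) : ℝ := if b then 1 else -1

lemma boolSign_not (b : Bool) : boolSign (!b) = -boolSign b := by
  cases b <;> simp [boolSign]

/-- The average of a function over the discrete cube. -/
noncomputable def cubeMean {n : ℕ} (f : (Fin n → Bool) → ℝ) : ℝ := (∑ x, f x) / 2 ^ n

/-- The point of the cube obtained by flipping one coordinate. -/
def cubeFlip {n : ℕ} (i : Fin n) (x : Fin n → Bool) : Fin n → Bool :=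
  Function.update x i (!x i)

/-- The Dirichlet form of the discrete cube. -/
noncomputable def cubeEnergy {n : ℕ} (f : (Fin n → Bool) → ℝ) : ℝ :=
  ∑ i, cubeMean fun x => ((f x - f (cubeFlip i x)) / 2) ^ 2

/-- The total squared weight of a function on the characters of degree one. -/
noncomputable def cubeLinearWeight {n : ℕ} (f : (Fin n → Bool) → ℝ) : ℝ :=
  ∑ i, (cubeMean fun x => boolSign (x i) * f x) ^ 2

section CubeMean

variable {n : ℕ}

lemma cubeMean_add (f g : (Fin n → Bool) → ℝ) :
    cubeMean (fun x => f x + g x) = cubeMean f + cubeMean g := by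
  simp only [cubeMean, Finset.sum_add_distrib, add_div]

lemma cubeMean_const_mul (c : ℝ) (f : (Fin n → Bool) → ℝ) :
    cubeMean (fun x => c * f x) = c * cubeMean f := by
  simp only [cubeMean, ← Finset.mul_sum, mul_div_assoc]

lemma cubeMean_const (c : ℝ) : cubeMean (fun _ : Fin n → Bool => c) = c := by
  simp [cubeMean]

lemma cubeMean_mono {f g : (Fin n → Bool) → ℝ} (h : ∀ x, f x ≤ g x) :
    cubeMean f ≤ cubeMean g := by
  unfold cubeMean
  gcongr with x
  exact h x

lemma cubeMean_sum {ι : Type*} (s : Finset ι) (f : ι → (Fin n → Bool) → ℝ) :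
    cubeMean (fun x => ∑ i ∈ s, f i x) = ∑ i ∈ s, cubeMean (f i) := by
  simp only [cubeMean, ← Finset.sum_div]
  rw [Finset.sum_comm]

lemma cubeMean_comp_involutive {e : (Fin n → Bool) → (Fin n → Bool)}
    (he : Function.Involutive e) (f : (Fin n → Bool) → ℝ) :
    cubeMean (fun x => f (e x)) = cubeMean f := by
  unfold cubeMean
  rw [he.bijective.sum_comp f]

lemma cubeFlip_involutive (i : Fin n) : Function.Involutive (cubeFlip i) := by
  intro x
  simp [cubeFlip]

lemma cubeNot_involutive :
    Function.Involutive (fun (x : Fin n → Bool) i => !x i) := by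
  intro x
  simp

lemma cubeMean_succ (f : (Fin (n + 1) → Bool) → ℝ) :
    cubeMean f = (cubeMean (fun x => f (Fin.cons true x)) +
      cubeMean (fun x => f (Fin.cons false x))) / 2 := by
  unfold cubeMean
  rw [← (Fin.consEquiv fun _ : Fin (n + 1) => Bool).sum_comp, Fintype.sum_prod_type]
  simp only [Fintype.sum_bool, pow_succ]
  field_simp
  rfl

lemma cubeFlip_zero_cons (b : Bool) (x : Fin n → Bool) :
    cubeFlip 0 (Fin.cons b x : Fin (n + 1) → Bool) = Fin.cons (!b) x := by
  simp [cubeFlip]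

lemma cubeFlip_succ_cons (i : Fin n) (b : Bool) (x : Fin n → Bool) :
    cubeFlip i.succ (Fin.cons b x : Fin (n + 1) → Bool) = Fin.cons b (cubeFlip i x) := by
  simp [cubeFlip, Fin.cons_update]

end CubeMean

section Extension

variable {n : ℕ} (g h : (Fin n → Bool) → ℝ)

/-- The function `g + ε h` on the cube with one more coordinate `ε`. -/
def cubeExtend (x : Fin (n + 1) → Bool) : ℝ :=
  g (Fin.tail x) + boolSign (x 0) * h (Fin.tail x)

lemma cubeExtend_true (x : Fin n → Bool) : cubeExtend g h (Fin.cons true x) = g x + h x := by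
  simp [cubeExtend, boolSign]

lemma cubeExtend_false (x : Fin n → Bool) :
    cubeExtend g h (Fin.cons false x) = g x + (-1) * h x := by
  simp [cubeExtend, boolSign]

lemma exists_eq_cubeExtend (f : (Fin (n + 1) → Bool) → ℝ) : ∃ g h, f = cubeExtend g h := by
  refine ⟨fun x => (f (Fin.cons true x) + f (Fin.cons false x)) / 2,
    fun x => (f (Fin.cons true x) - f (Fin.cons false x)) / 2, ?_⟩
  funext x
  induction x using Fin.consCases with
  | _ b x => cases b <;> simp only [cubeExtend_true, cubeExtend_false] <;> ring

lemma cubeMean_cubeExtend : cubeMean (cubeExtend g h) = cubeMean g := by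
  simp only [cubeMean_succ, cubeExtend_true, cubeExtend_false, cubeMean_add, cubeMean_const_mul]
  ring

lemma cubeMean_sq_add_sq_sub :
    (cubeMean (fun x => (g x + h x) ^ 2) + cubeMean (fun x => (g x + (-1) * h x) ^ 2)) / 2 =
      cubeMean (fun x => g x ^ 2) + cubeMean (fun x => h x ^ 2) := by
  rw [← cubeMean_add, ← cubeMean_add]
  have : (fun x => (g x + h x) ^ 2 + (g x + (-1) * h x) ^ 2) =
      fun x => 2 * (g x ^ 2 + h x ^ 2) := by
    funext x
    ring
  rw [this, cubeMean_const_mul]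
  ring

lemma cubeMean_sq_cubeExtend :
    cubeMean (fun x => cubeExtend g h x ^ 2) =
      cubeMean (fun x => g x ^ 2) + cubeMean (fun x => h x ^ 2) := by
  rw [cubeMean_succ]
  simp only [cubeExtend_true, cubeExtend_false]
  exact cubeMean_sq_add_sq_sub g h

lemma cubeLinearWeight_cubeExtend :
    cubeLinearWeight (cubeExtend g h) = cubeMean h ^ 2 + cubeLinearWeight g := by
  unfold cubeLinearWeight
  rw [Fin.sum_univ_succ]
  congr 1
  · simp only [cubeMean_succ, Fin.cons_zero, cubeExtend_true, cubeExtend_false,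
      cubeMean_add, cubeMean_const_mul]
    simp only [boolSign, if_true, Bool.false_eq_true, if_false]
    ring
  · refine Finset.sum_congr rfl fun i _ => ?_
    have : (fun x => boolSign (x i.succ) * cubeExtend g h x) =
        cubeExtend (fun x => boolSign (x i) * g x) (fun x => boolSign (x i) * h x) := by
      funext x
      simp only [cubeExtend, Fin.tail]
      ring
    rw [this, cubeMean_cubeExtend]

lemma cubeEnergy_cubeExtend :
    cubeEnergy (cubeExtend g h) =
      cubeMean (fun x => h x ^ 2) + (cubeEnergy g + cubeEnergy h) := by
  unfold cubeEnergy
  rw [Fin.sum_univ_succ, ← Finset.sum_add_distrib]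
  congr 1
  · rw [cubeMean_succ]
    simp only [cubeFlip_zero_cons, Bool.not_true, Bool.not_false, cubeExtend_true,
      cubeExtend_false]
    have h₁ : (fun x => ((g x + h x - (g x + (-1) * h x)) / 2) ^ 2) = fun x => h x ^ 2 := by
      funext x
      ring
    have h₂ : (fun x => ((g x + (-1) * h x - (g x + h x)) / 2) ^ 2) = fun x => h x ^ 2 := by
      funext x
      ring
    rw [h₁, h₂]
    ring
  · refine Finset.sum_congr rfl fun i _ => ?_
    rw [← cubeMean_sq_add_sq_sub, cubeMean_succ]
    simp only [cubeFlip_succ_cons, cubeExtend_true, cubeExtend_false]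
    congr 3
    all_goals
      funext x
      ring

end Extension

/-- The Poincaré inequality on the discrete cube. -/
lemma cubeMean_sq_le_add_cubeEnergy {n : ℕ} (f : (Fin n → Bool) → ℝ) :
    cubeMean (fun x => f x ^ 2) ≤ cubeMean f ^ 2 + cubeEnergy f := by
  induction n with
  | zero => simp [cubeMean, cubeEnergy]
  | succ n ih =>
    obtain ⟨g, h, rfl⟩ := exists_eq_cubeExtend f
    have h_nonneg : 0 ≤ cubeEnergy h := by
      unfold cubeEnergy cubeMean
      positivity
    rw [cubeMean_sq_cubeExtend, cubeMean_cubeExtend, cubeEnergy_cubeExtend]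
    linarith [ih g]

/-- The Poincaré inequality on the discrete cube, improved by splitting off degree one. -/
lemma two_mul_cubeMean_sq_le {n : ℕ} (f : (Fin n → Bool) → ℝ) :
    2 * cubeMean (fun x => f x ^ 2) ≤
      2 * cubeMean f ^ 2 + cubeLinearWeight f + cubeEnergy f := by
  induction n with
  | zero => simp [cubeMean, cubeEnergy, cubeLinearWeight]
  | succ n ih =>
    obtain ⟨g, h, rfl⟩ := exists_eq_cubeExtend f
    rw [cubeMean_sq_cubeExtend, cubeMean_cubeExtend, cubeEnergy_cubeExtend,
      cubeLinearWeight_cubeExtend]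
    linarith [ih g, cubeMean_sq_le_add_cubeEnergy h]

lemma cubeLinearWeight_eq_zero_of_even {n : ℕ} {f : (Fin n → Bool) → ℝ}
    (hf : ∀ x, f (fun i => !x i) = f x) : cubeLinearWeight f = 0 := by
  refine Finset.sum_eq_zero fun i _ => ?_
  have h := cubeMean_comp_involutive cubeNot_involutive (fun x => boolSign (x i) * f x)
  simp only [boolSign_not, hf] at h
  have h' : cubeMean (fun x => -boolSign (x i) * f x) =
      -1 * cubeMean (fun x => boolSign (x i) * f x) := by
    rw [← cubeMean_const_mul]
    congr! 2 with x
    ring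
  have h₀ : cubeMean (fun x => boolSign (x i) * f x) = 0 := by linarith
  rw [h₀]
  ring

/-- The Dirichlet form as the quadratic form of the graph Laplacian. -/
lemma cubeEnergy_eq {n : ℕ} (f : (Fin n → Bool) → ℝ) :
    cubeEnergy f = cubeMean (fun x => f x * ∑ i, (f x - f (cubeFlip i x))) / 2 := by
  simp only [Finset.mul_sum]
  rw [cubeMean_sum, Finset.sum_div]
  refine Finset.sum_congr rfl fun i _ => ?_
  have h := cubeMean_comp_involutive (cubeFlip_involutive i)
    (fun x => f x * (f x - f (cubeFlip i x)))
  simp only [cubeFlip_involutive i _] at h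
  have h' : (fun x => ((f x - f (cubeFlip i x)) / 2) ^ 2) = fun x =>
      (1 / 4) * (f x * (f x - f (cubeFlip i x)) +
        f (cubeFlip i x) * (f (cubeFlip i x) - f x)) := by
    funext x
    ring
  rw [h', cubeMean_const_mul, cubeMean_add, h]
  ring

section Khintchine

variable {n : ℕ} (v : Fin n → ℝ)

/-- The linear form `∑ i, ε i * v i` in Rademacher signs. -/
def signSum (x : Fin n → Bool) : ℝ := ∑ i, boolSign (x i) * v i

lemma signSum_not (x : Fin n → Bool) : signSum v (fun i => !x i) = -signSum v x := by
  simp [signSum, boolSign_not]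

lemma signSum_cubeFlip (i : Fin n) (x : Fin n → Bool) :
    signSum v (cubeFlip i x) = signSum v x - 2 * (boolSign (x i) * v i) := by
  unfold signSum
  rw [← Finset.add_sum_erase _ _ (Finset.mem_univ i),
    ← Finset.add_sum_erase _ (fun j => boolSign (x j) * v j) (Finset.mem_univ i)]
  have h : ∑ j ∈ Finset.univ.erase i, boolSign (cubeFlip i x j) * v j =
      ∑ j ∈ Finset.univ.erase i, boolSign (x j) * v j := by
    refine Finset.sum_congr rfl fun j hj => ?_
    simp [cubeFlip, Function.update_of_ne (Finset.ne_of_mem_erase hj)]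
  rw [h]
  simp only [cubeFlip, Function.update_self, boolSign_not]
  ring

lemma sum_abs_signSum_sub_le (x : Fin n → Bool) :
    ∑ i, (|signSum v x| - |signSum v (cubeFlip i x)|) ≤ 2 * |signSum v x| := by
  have h : ∑ i, signSum v (cubeFlip i x) = (n - 2) * signSum v x := by
    simp only [signSum_cubeFlip, Finset.sum_sub_distrib, ← Finset.mul_sum]
    simp [signSum]
    ring
  have h' : ((n : ℝ) - 2) * |signSum v x| ≤ ∑ i, |signSum v (cubeFlip i x)| :=
    calc ((n : ℝ) - 2) * |signSum v x| ≤ |(n : ℝ) - 2| * |signSum v x| := by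
          gcongr
          exact le_abs_self _
      _ = |∑ i, signSum v (cubeFlip i x)| := by rw [h, abs_mul]
      _ ≤ _ := Finset.abs_sum_le_sum_abs _ _
  rw [Finset.sum_sub_distrib]
  simp only [Finset.sum_const, Finset.card_univ, Fintype.card_fin, nsmul_eq_mul]
  linarith

lemma cubeMean_signSum_sq {n : ℕ} (v : Fin n → ℝ) :
    cubeMean (fun x => signSum v x ^ 2) = ∑ i, v i ^ 2 := by
  induction n with
  | zero => simp [cubeMean, signSum]
  | succ n ih =>
    have h : signSum v = cubeExtend (signSum (Fin.tail v)) (fun _ => v 0) := by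
      funext x
      simp only [signSum, cubeExtend, Fin.sum_univ_succ, Fin.tail]
      ring
    rw [h, cubeMean_sq_cubeExtend, ih, cubeMean_const, Fin.sum_univ_succ, add_comm]
    rfl

/-- The Khintchine inequality between the first and second moments, with Szarek's optimal
constant; the argument is due to Latała and Oleszkiewicz. -/
theorem sqrt_sum_sq_le_sqrt_two_mul_cubeMean_abs :
    √(∑ i, v i ^ 2) ≤ √2 * cubeMean (fun x => |signSum v x|) := by
  have h_energy : cubeEnergy (fun x => |signSum v x|) ≤ ∑ i, v i ^ 2 := by
    have h : cubeMean (fun x => |signSum v x| *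
        ∑ i, (|signSum v x| - |signSum v (cubeFlip i x)|)) ≤
        cubeMean (fun x => 2 * signSum v x ^ 2) := by
      refine cubeMean_mono fun x => ?_
      rw [← sq_abs (signSum v x)]
      nlinarith [sum_abs_signSum_sub_le v x, abs_nonneg (signSum v x)]
    rw [cubeMean_const_mul, cubeMean_signSum_sq] at h
    rw [cubeEnergy_eq]
    linarith
  have h_poincare := two_mul_cubeMean_sq_le (fun x => |signSum v x|)
  rw [cubeLinearWeight_eq_zero_of_even fun x => by rw [signSum_not, abs_neg]] at h_poincare
  simp only [sq_abs, cubeMean_signSum_sq] at h_poincare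
  have h_nonneg : 0 ≤ cubeMean (fun x => |signSum v x|) := by
    unfold cubeMean
    positivity
  rw [Real.sqrt_le_left (by positivity), mul_pow, Real.sq_sqrt (by norm_num)]
  linarith

end Khintchine

theorem stmt16 {X : Type*} (x : X) {C : ℕ} (hC : 0 < C)
    (H : Set (X → (Fin C → ℝ))) (hH : H.Nonempty)
    (φ : (X → (Fin C → ℝ)) → ℝ) (a : ℝ) (ha : 0 < a)
    (lam : (Fin C → ℝ) → ℝ) (L : ℝ) (hL : 0 ≤ L)
    (hlam : ∀ u v : Fin C → ℝ, |lam u - lam v| ≤ L * Real.sqrt (∑ c, (u c - v c) ^ 2))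
    (hbddL : ∀ ε : Bool,
      BddAbove ((fun f => (if ε then (1 : ℝ) else -1) * a * lam (f x) + φ f) '' H))
    (hbddR : ∀ ε : Fin C → Bool,
      BddAbove ((fun f =>
        Real.sqrt 2 * a * L * ∑ c, (if ε c then (1 : ℝ) else -1) * f x c + φ f) '' H)) :
    (∑ ε : Bool, sSup ((fun f => (if ε then (1 : ℝ) else -1) * a * lam (f x) + φ f) '' H)) / 2
      ≤ (∑ ε : Fin C → Bool, sSup ((fun f =>
          Real.sqrt 2 * a * L * ∑ c, (if ε c then (1 : ℝ) else -1) * f x c + φ f) '' H))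
        / 2 ^ C := by
  set B : ℝ := √2 * a * L with hB
  set S : (Fin C → Bool) → ℝ := fun ε => sSup ((fun f =>
    B * ∑ c, (if ε c then (1 : ℝ) else -1) * f x c + φ f) '' H)
  have le_S : ∀ ε, ∀ f ∈ H, B * signSum (f x) ε + φ f ≤ S ε := fun ε f hf =>
    le_csSup (hbddR ε) (Set.mem_image_of_mem _ hf)
  have le_pair : ∀ f ∈ H, ∀ g ∈ H, ∀ ε,
      B * |signSum (fun c => f x c - g x c) ε| + (φ f + φ g) ≤ S ε + S (fun c => !ε c) := by
    intro f hf g hg ε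
    have h_sub : signSum (fun c => f x c - g x c) ε = signSum (f x) ε - signSum (g x) ε := by
      simp only [signSum, mul_sub, Finset.sum_sub_distrib]
    have hf₁ := le_S ε f hf
    have hg₁ := le_S ε g hg
    have hf₂ := le_S (fun c => !ε c) f hf
    have hg₂ := le_S (fun c => !ε c) g hg
    rw [signSum_not] at hf₂ hg₂
    rw [h_sub]
    rcases abs_cases (signSum (f x) ε - signSum (g x) ε) with h | h <;> rw [h.1] <;> linarith
  have key : ∀ f ∈ H, ∀ g ∈ H,
      (a * lam (f x) + φ f) + (-1 * a * lam (g x) + φ g) ≤ 2 * cubeMean S := by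
    intro f hf g hg
    have h_mean := cubeMean_mono (le_pair f hf g hg)
    rw [cubeMean_add, cubeMean_const_mul, cubeMean_const, cubeMean_add,
      cubeMean_comp_involutive cubeNot_involutive S] at h_mean
    have h_lam : lam (f x) - lam (g x) ≤
        L * (√2 * cubeMean (fun ε => |signSum (fun c => f x c - g x c) ε|)) :=
      calc lam (f x) - lam (g x) ≤ L * √(∑ c, (f x c - g x c) ^ 2) :=
            (le_abs_self _).trans (hlam _ _)
        _ ≤ _ := by
            gcongr
            exact sqrt_sum_sq_le_sqrt_two_mul_cubeMean_abs _
    have h_scaled := mul_le_mul_of_nonneg_left h_lam ha.le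
    rw [hB] at h_mean
    linarith
  change _ ≤ cubeMean S
  rw [div_le_iff₀ two_pos, mul_comm, Fintype.sum_bool]
  simp only [if_true, Bool.false_eq_true, if_false, one_mul]
  rw [← le_sub_iff_add_le]
  refine csSup_le (hH.image _) ?_
  rintro _ ⟨f, hf, rfl⟩
  rw [le_sub_comm]
  refine csSup_le (hH.image _) ?_
  rintro _ ⟨g, hg, rfl⟩
  linarith [key f hf g hg]
end

section
/- Let X be a set, x_1, …, x_M ∈ X, a_1, …, a_M ≥ 0, let G be a set of functions X → ℝ, let μ : ℝ → ℝ be Lipschitz with constant L ≥ 0, let β > 0 and d ≥ 1, and suppose there exists f₀ ∈ G with μ(f₀(x)) = 0 for all x ∈ X. Define G' = { x ↦ ∑_{j=1}^d v_j μ(f_j(x)) : v ∈ ℝ^d with ∑_{j=1}^d |v_j| ≤ β, and f_1, …, f_d ∈ G }. Assume that for every sign vector ε ∈ {−1,1}^M the suprema sup_{g∈G} ∑_i a_i ε_i g(x_i), sup_{g∈G} ∑_i a_i ε_i μ(g(x_i)), and sup_{g'∈G'} ∑_i a_i ε_i g'(x_i) are all finite. Then Rad_{S,a}(G') ≤ 2βL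 · Rad_{S,a}(G). (This is the one-layer peeling step bounding the weighted Rademacher average of a multilayer perceptron layer, with ℓ¹-bounded output weights and 1-Lipschitz activation μ, in terms of that of the previous layer's function class.) -/
theorem ciSup_add_ciSup_sub_le {T : Type*} [Nonempty T] {w u v : T → ℝ}
    (huv : ∀ s t, |u s - u t| ≤ |v s - v t|)
    (hadd : BddAbove (Set.range fun t => w t + v t))
    (hsub : BddAbove (Set.range fun t => w t - v t)) :
    (⨆ t, (w t + u t)) + ⨆ t, (w t - u t) ≤ (⨆ t, (w t + v t)) + ⨆ t, (w t - v t) := by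
  rw [← le_sub_iff_add_le]
  refine ciSup_le fun s => ?_
  rw [le_sub_comm]
  refine ciSup_le fun t => ?_
  have h := (le_abs_self _).trans (huv s t)
  have h1 := le_ciSup hadd s
  have h2 := le_ciSup hadd t
  have h3 := le_ciSup hsub s
  have h4 := le_ciSup hsub t
  rcases abs_cases (v s - v t) with ⟨h', _⟩ | ⟨h', _⟩ <;> linarith

theorem sign_mul_le_abs (b : Bool) (r : ℝ) : (if b then (1 : ℝ) else -1) * r ≤ |r| := by
  cases b
  · simpa using neg_le_abs r
  · simpa using le_abs_self r

theorem sum_sign_cons {M : ℕ} (b : Bool) (ε : Fin M → Bool) (r : Fin (M + 1) → ℝ) :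
    ∑ i, (if (Fin.cons b ε : Fin (M + 1) → Bool) i then (1 : ℝ) else -1) * r i =
      (if b then (1 : ℝ) else -1) * r 0 + ∑ i, (if ε i then (1 : ℝ) else -1) * r i.succ := by
  rw [Fin.sum_univ_succ]
  simp only [Fin.cons_zero, Fin.cons_succ]

theorem sum_signs_succ {M : ℕ} (F : (Fin (M + 1) → Bool) → ℝ) :
    ∑ ε, F ε = ∑ b : Bool, ∑ ε : Fin M → Bool, F (Fin.cons b ε) := by
  rw [← Fintype.sum_prod_type']
  exact (Fintype.sum_equiv (Fin.consEquiv fun _ => Bool) _ _ fun _ => rfl).symm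

/-- The Ledoux–Talagrand contraction principle, with an additive offset `c`. -/
theorem sum_signs_ciSup_contraction {T : Type*} [Nonempty T] {M : ℕ} (c : T → ℝ)
    (u v : Fin M → T → ℝ) (huv : ∀ i s t, |u i s - u i t| ≤ |v i s - v i t|)
    (hbdd : BddAbove (Set.range fun t => c t + ∑ i, |v i t|)) :
    ∑ ε : Fin M → Bool, ⨆ t, (c t + ∑ i, (if ε i then (1 : ℝ) else -1) * u i t) ≤
      ∑ ε : Fin M → Bool, ⨆ t, (c t + ∑ i, (if ε i then (1 : ℝ) else -1) * v i t) := by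
  induction M generalizing c with
  | zero => simp
  | succ M ih =>
    obtain ⟨B, hB⟩ := hbdd
    have hB' (t : T) : c t + (|v 0 t| + ∑ i : Fin M, |v i.succ t|) ≤ B := by
      rw [← Fin.sum_univ_succ fun i => |v i t|]
      exact hB ⟨t, rfl⟩
    have bdd_head (b : Bool) : BddAbove (Set.range fun t =>
        (c t + (if b then (1 : ℝ) else -1) * u 0 t) + ∑ i : Fin M, |v i.succ t|) := by
      obtain ⟨t₀⟩ := ‹Nonempty T›
      refine ⟨B + |u 0 t₀| + |v 0 t₀|, ?_⟩
      rintro _ ⟨t, rfl⟩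
      have h1 := sign_mul_le_abs b (u 0 t)
      have h2 := abs_sub_abs_le_abs_sub (u 0 t) (u 0 t₀)
      have h3 := abs_sub (v 0 t) (v 0 t₀)
      have h4 := huv 0 t t₀
      have h5 := hB' t
      dsimp only
      linarith
    have bdd_tail (b : Bool) (ε : Fin M → Bool) : BddAbove (Set.range fun t =>
        (c t + ∑ i, (if ε i then (1 : ℝ) else -1) * v i.succ t) +
          (if b then (1 : ℝ) else -1) * v 0 t) := by
      refine ⟨B, ?_⟩
      rintro _ ⟨t, rfl⟩
      have h1 := sign_mul_le_abs b (v 0 t)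
      have h2 : ∑ i, (if ε i then (1 : ℝ) else -1) * v i.succ t ≤
          ∑ i : Fin M, |v i.succ t| :=
        Finset.sum_le_sum fun i _ => sign_mul_le_abs _ _
      have h5 := hB' t
      dsimp only
      linarith
    rw [sum_signs_succ, sum_signs_succ]
    simp only [sum_sign_cons _ _ fun i => u i _, sum_sign_cons _ _ fun i => v i _, ← add_assoc]
    refine (Finset.sum_le_sum fun b _ =>
      ih _ (fun i => u (Fin.succ i)) (fun i => v (Fin.succ i)) (fun i => huv (Fin.succ i))
        (bdd_head b)).trans ?_
    rw [Finset.sum_comm, Finset.sum_comm (s := (Finset.univ : Finset Bool))]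
    refine Finset.sum_le_sum fun ε _ => ?_
    have h := ciSup_add_ciSup_sub_le (huv 0)
      (by simpa using bdd_tail true ε) (by simpa [← sub_eq_add_neg] using bdd_tail false ε)
    simpa [add_right_comm, sub_eq_add_neg] using h

theorem bddAbove_sum_abs_of_forall_signs {T : Type*} {M : ℕ} (v : Fin M → T → ℝ)
    (h : ∀ ε : Fin M → Bool,
      BddAbove (Set.range fun t => ∑ i, (if ε i then (1 : ℝ) else -1) * v i t)) :
    BddAbove (Set.range fun t => ∑ i, |v i t|) := by
  choose B hB using h
  refine ⟨∑ ε, |B ε|, ?_⟩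
  rintro _ ⟨t, rfl⟩
  let ε : Fin M → Bool := fun i => decide (0 ≤ v i t)
  calc ∑ i, |v i t| = ∑ i, (if ε i then (1 : ℝ) else -1) * v i t := by
        refine Finset.sum_congr rfl fun i _ => ?_
        by_cases hi : 0 ≤ v i t
        · simp [ε, hi, abs_of_nonneg hi]
        · simp [ε, hi, abs_of_neg (not_le.mp hi)]
    _ ≤ B ε := hB ε ⟨t, rfl⟩
    _ ≤ |B ε| := le_abs_self _
    _ ≤ ∑ ε, |B ε| :=
        Finset.single_le_sum (f := fun ε => |B ε|) (fun _ _ => abs_nonneg _) (Finset.mem_univ ε)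

theorem sum_le_mul_of_forall_abs_le {d : ℕ} {v q : Fin d → ℝ} {β C : ℝ}
    (hv : ∑ j, |v j| ≤ β) (hC : 0 ≤ C) (hq : ∀ j, |q j| ≤ C) : ∑ j, v j * q j ≤ β * C :=
  calc ∑ j, v j * q j ≤ ∑ j, |v j| * C := Finset.sum_le_sum fun j _ =>
        (le_abs_self _).trans <| by
          rw [abs_mul]
          exact mul_le_mul_of_nonneg_left (hq j) (abs_nonneg _)
    _ = (∑ j, |v j|) * C := (Finset.sum_mul ..).symm
    _ ≤ β * C := mul_le_mul_of_nonneg_right hv hC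

theorem sum_signs_not {M : ℕ} (F : (Fin M → Bool) → ℝ) :
    ∑ ε : Fin M → Bool, F (fun i => !ε i) = ∑ ε, F ε :=
  Fintype.sum_equiv (Equiv.arrowCongr (Equiv.refl _) Equiv.boolNot) _ _ fun _ => rfl

/-- Lipschitz contraction for the weighted Rademacher average, before normalisation. -/
theorem sum_signs_sSup_comp_le {X : Type*} {M : ℕ} (x : Fin M → X) (a : Fin M → ℝ)
    (G : Set (X → ℝ)) (hG : G.Nonempty)
    (μ : ℝ → ℝ) (L : ℝ) (hL : 0 ≤ L) (hμ : ∀ s t : ℝ, |μ s - μ t| ≤ L * |s - t|)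
    (hbddG : ∀ ε : Fin M → Bool,
      BddAbove ((fun g => ∑ i, a i * (if ε i then (1 : ℝ) else -1) * g (x i)) '' G)) :
    ∑ ε : Fin M → Bool,
        sSup ((fun g => ∑ i, a i * (if ε i then (1 : ℝ) else -1) * μ (g (x i))) '' G) ≤
      L * ∑ ε : Fin M → Bool,
        sSup ((fun g => ∑ i, a i * (if ε i then (1 : ℝ) else -1) * g (x i)) '' G) := by
  have : Nonempty G := hG.to_subtype
  let v : Fin M → G → ℝ := fun i g => a i * (L * g.1 (x i))
  have hv (ε : Fin M → Bool) (g : G) : ∑ i, (if ε i then (1 : ℝ) else -1) * v i g =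
      L * ∑ i, a i * (if ε i then (1 : ℝ) else -1) * g.1 (x i) := by
    rw [Finset.mul_sum]
    exact Finset.sum_congr rfl fun i _ => by ring
  have hbdd : BddAbove (Set.range fun g => ∑ i, |v i g|) := by
    refine bddAbove_sum_abs_of_forall_signs v fun ε => ?_
    obtain ⟨B, hB⟩ := hbddG ε
    refine ⟨L * B, ?_⟩
    rintro _ ⟨g, rfl⟩
    dsimp only
    rw [hv]
    exact mul_le_mul_of_nonneg_left (hB ⟨g, g.2, rfl⟩) hL
  have key := sum_signs_ciSup_contraction (fun _ : G => (0 : ℝ))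
    (fun i g => a i * μ (g.1 (x i))) v
    (fun i s t => by
      simp only [v, ← mul_sub, abs_mul, abs_of_nonneg hL]
      exact mul_le_mul_of_nonneg_left (hμ _ _) (abs_nonneg _))
    (by simpa using hbdd)
  simp only [hv, zero_add, ← Real.mul_iSup_of_nonneg hL, ← Finset.mul_sum] at key
  simpa only [sSup_image', mul_assoc, mul_left_comm] using key


theorem stmt19 {X : Type*} {M : ℕ} (x : Fin M → X) (a : Fin M → ℝ) (ha : ∀ i, 0 ≤ a i)
    (G : Set (X → ℝ))
    (μ : ℝ → ℝ) (L : ℝ) (hL : 0 ≤ L) (hμ : ∀ s t : ℝ, |μ s - μ t| ≤ L * |s - t|)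
    (β : ℝ) (hβ : 0 < β) {d : ℕ} (hd : 0 < d)
    (f₀ : X → ℝ) (hf₀ : f₀ ∈ G) (hf₀μ : ∀ y : X, μ (f₀ y) = 0)
    (G' : Set (X → ℝ))
    (hG' : G' = {g' : X → ℝ | ∃ (v : Fin d → ℝ) (f : Fin d → (X → ℝ)),
      (∑ j, |v j|) ≤ β ∧ (∀ j, f j ∈ G) ∧ g' = fun y => ∑ j, v j * μ (f j y)})
    (hbddG : ∀ ε : Fin M → Bool,
      BddAbove ((fun g => ∑ i, a i * (if ε i then (1 : ℝ) else -1) * g (x i)) '' G))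
    (hbddμG : ∀ ε : Fin M → Bool,
      BddAbove ((fun g => ∑ i, a i * (if ε i then (1 : ℝ) else -1) * μ (g (x i))) '' G))
    (hbddG' : ∀ ε : Fin M → Bool,
      BddAbove ((fun g => ∑ i, a i * (if ε i then (1 : ℝ) else -1) * g (x i)) '' G')) :
    Rad x a G' ≤ 2 * β * L * Rad x a G := by
  let A : (Fin M → Bool) → ℝ := fun ε =>
    sSup ((fun g => ∑ i, a i * (if ε i then (1 : ℝ) else -1) * μ (g (x i))) '' G)
  have le_A (ε : Fin M → Bool) {f : X → ℝ} (hf : f ∈ G) :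
      ∑ i, a i * (if ε i then (1 : ℝ) else -1) * μ (f (x i)) ≤ A ε :=
    le_csSup (hbddμG ε) ⟨f, hf, rfl⟩
  have A_nonneg (ε : Fin M → Bool) : 0 ≤ A ε := by simpa [hf₀μ] using le_A ε hf₀
  have abs_le_A (ε : Fin M → Bool) {f : X → ℝ} (hf : f ∈ G) :
      |∑ i, a i * (if ε i then (1 : ℝ) else -1) * μ (f (x i))| ≤ A ε + A fun i => !ε i := by
    have h1 := le_A ε hf
    have h2 := le_A (fun i => !ε i) hf
    have h3 : ∑ i, a i * (if !ε i then (1 : ℝ) else -1) * μ (f (x i)) =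
        -∑ i, a i * (if ε i then (1 : ℝ) else -1) * μ (f (x i)) := by
      rw [← Finset.sum_neg_distrib]
      exact Finset.sum_congr rfl fun i _ => by cases ε i <;> simp
    rw [h3] at h2
    exact abs_le.mpr ⟨by linarith [A_nonneg ε], by linarith [A_nonneg fun i => !ε i]⟩
  have sup_le (ε : Fin M → Bool) :
      sSup ((fun g => ∑ i, a i * (if ε i then (1 : ℝ) else -1) * g (x i)) '' G') ≤
        β * (A ε + A fun i => !ε i) := by
    have hC := add_nonneg (A_nonneg ε) (A_nonneg fun i => !ε i)
    refine Real.sSup_le ?_ (mul_nonneg hβ.le hC)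
    subst hG'
    rintro _ ⟨_, ⟨v, f, hv, hf, rfl⟩, rfl⟩
    refine le_of_eq_of_le ?_ (sum_le_mul_of_forall_abs_le hv hC fun j => abs_le_A ε (hf j))
    simp only [Finset.mul_sum]
    rw [Finset.sum_comm]
    exact Finset.sum_congr rfl fun j _ => Finset.sum_congr rfl fun i _ => by ring
  have contraction := sum_signs_sSup_comp_le x a G ⟨f₀, hf₀⟩ μ L hL hμ hbddG
  unfold Rad
  rw [← mul_div_assoc]
  refine div_le_div_of_nonneg_right ?_ (by positivity)
  calc _ ≤ ∑ ε, β * (A ε + A fun i => !ε i) := Finset.sum_le_sum fun ε _ => sup_le ε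
    _ = 2 * β * ∑ ε, A ε := by
        rw [← Finset.mul_sum, Finset.sum_add_distrib, sum_signs_not]
        ring
    _ ≤ _ := by
        rw [mul_assoc (2 * β) L]
        exact mul_le_mul_of_nonneg_left contraction (by positivity)
end
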